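/- arXiv:1503.00634 — 3 statements merged into one kernel-verified Lean document; each statement's English description precedes it below -/
import Mathlib

section
/- Let ξ₁, ξ₂ be real numbers with (ξ₁, ξ₂) ≠ (0, 0). Then the complex 3×3 matrix M(ξ₁,ξ₂) with rows (−iρ, 0, iξ₁), (0, −iρ, iξ₂), (iξ₁, iξ₂, iρ), where ρ = √(ξ₁² + ξ₂²), is invertible (equivalently, its determinant is nonzero). -/
open Complex Matrix

/-- For (ξ₁, ξ₂) ≠ (0, 0) and ρ = √(ξ₁² + ξ₂²), the 3×3 complex matrix
with rows (−iρ, 0, iξ₁), (0, −iρ, iξ₂), (iξ₁, iξ₂, iρ) is invertible; equivalently,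
its determinant is nonzero. -/
theorem boundary_symbol_invertible (ξ₁ ξ₂ ρ : ℝ) (hξ : (ξ₁, ξ₂) ≠ (0, 0))
    (hρ : ρ = Real.sqrt (ξ₁ ^ 2 + ξ₂ ^ 2)) :
    IsUnit (!![-Complex.I * (ρ : ℂ), 0, Complex.I * (ξ₁ : ℂ);
        0, -Complex.I * (ρ : ℂ), Complex.I * (ξ₂ : ℂ);
        Complex.I * (ξ₁ : ℂ), Complex.I * (ξ₂ : ℂ), Complex.I * (ρ : ℂ)]) ∧
    (!![-Complex.I * (ρ : ℂ), 0, Complex.I * (ξ₁ : ℂ);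
        0, -Complex.I * (ρ : ℂ), Complex.I * (ξ₂ : ℂ);
        Complex.I * (ξ₁ : ℂ), Complex.I * (ξ₂ : ℂ), Complex.I * (ρ : ℂ)]).det ≠ 0 := by
  have hsum_ne : ξ₁ ^ 2 + ξ₂ ^ 2 ≠ 0 := by
    intro h
    apply hξ
    have h₁ : ξ₁ = 0 := by nlinarith [sq_nonneg ξ₁, sq_nonneg ξ₂]
    have h₂ : ξ₂ = 0 := by nlinarith [sq_nonneg ξ₁, sq_nonneg ξ₂]
    rw [h₁, h₂]
  have hρ_sq : ρ ^ 2 = ξ₁ ^ 2 + ξ₂ ^ 2 := by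
    rw [hρ, Real.sq_sqrt (by positivity)]
  have hρ_ne : ρ ≠ 0 := by
    rintro rfl
    exact hsum_ne (by simpa using hρ_sq.symm)
  have hρ_sq' : (ρ : ℂ) ^ 2 = (ξ₁ : ℂ) ^ 2 + (ξ₂ : ℂ) ^ 2 := by exact_mod_cast hρ_sq
  rw [Matrix.isUnit_iff_isUnit_det, isUnit_iff_ne_zero, and_self]
  have hdet : (!![-Complex.I * (ρ : ℂ), 0, Complex.I * (ξ₁ : ℂ);
      0, -Complex.I * (ρ : ℂ), Complex.I * (ξ₂ : ℂ);
      Complex.I * (ξ₁ : ℂ), Complex.I * (ξ₂ : ℂ), Complex.I * (ρ : ℂ)]).det =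
      -2 * Complex.I * (ρ : ℂ) ^ 3 := by
    simp [Matrix.det_fin_three]
    linear_combination (Complex.I * ρ * (ρ ^ 2 + ξ₁ ^ 2 + ξ₂ ^ 2)) * Complex.I_sq +
      Complex.I * (ρ : ℂ) * hρ_sq'
  rw [hdet]
  simp [hρ_ne]
end

section
/- Let ω > 0 and μ > 0 be real, let ε' ∈ ℂ, set k² = ω²ε'μ, let U ⊆ ℝ³ be open, and let e : ℝ³ → ℂ³ be twice continuously differentiable on U with Δe + k²·e = 0 (componentwise) and div e = 0 on U. Define h = (1/(iωμ))·curl e. Then the pair (e, h) satisfies the Maxwell system on U: curl e = iωμ·h and curl h = −iωε'·e. -/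
/-- Partial derivative in the j-th coordinate direction of a scalar function on ℝ³. -/
noncomputable def pd (j : Fin 3) (g : (Fin 3 → ℝ) → ℂ) (x : Fin 3 → ℝ) : ℂ :=
  fderiv ℝ g x (Pi.single j 1)

/-- Divergence of a vector field f : ℝ³ → ℂ³. -/
noncomputable def vdiv (f : (Fin 3 → ℝ) → Fin 3 → ℂ) (x : Fin 3 → ℝ) : ℂ :=
  pd 0 (fun y => f y 0) x + pd 1 (fun y => f y 1) x + pd 2 (fun y => f y 2) x

/-- Curl of a vector field f : ℝ³ → ℂ³. -/
noncomputable def vcurl (f : (Fin 3 → ℝ) → Fin 3 → ℂ) (x : Fin 3 → ℝ) : Fin 3 → ℂ :=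
  ![pd 1 (fun y => f y 2) x - pd 2 (fun y => f y 1) x,
    pd 2 (fun y => f y 0) x - pd 0 (fun y => f y 2) x,
    pd 0 (fun y => f y 1) x - pd 1 (fun y => f y 0) x]

/-- Componentwise vector Laplacian of f : ℝ³ → ℂ³. -/
noncomputable def vlap (f : (Fin 3 → ℝ) → Fin 3 → ℂ) (x : Fin 3 → ℝ) : Fin 3 → ℂ :=
  fun i => pd 0 (pd 0 (fun y => f y i)) x + pd 1 (pd 1 (fun y => f y i)) x
    + pd 2 (pd 2 (fun y => f y i)) x

theorem differentiableAt_pd {g : (Fin 3 → ℝ) → ℂ} {x : Fin 3 → ℝ} (hg : ContDiffAt ℝ 2 g x)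
    (j : Fin 3) : DifferentiableAt ℝ (pd j g) x :=
  ((hg.fderiv_right (m := 1) (by norm_num)).differentiableAt one_ne_zero).clm_apply
    (differentiableAt_const _)

theorem pd_pd_eq {g : (Fin 3 → ℝ) → ℂ} {x : Fin 3 → ℝ} (hg : ContDiffAt ℝ 2 g x)
    (i j : Fin 3) :
    pd i (pd j g) x = fderiv ℝ (fderiv ℝ g) x (Pi.single i 1) (Pi.single j 1) := by
  have hd : DifferentiableAt ℝ (fderiv ℝ g) x :=
    (hg.fderiv_right (m := 1) (by norm_num)).differentiableAt one_ne_zero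
  have h := hd.hasFDerivAt.clm_apply (hasFDerivAt_const (Pi.single j (1 : ℝ)) x)
  change fderiv ℝ (fun y => fderiv ℝ g y (Pi.single j 1)) x (Pi.single i 1) = _
  rw [h.fderiv]
  simp

theorem pd_comm {g : (Fin 3 → ℝ) → ℂ} {x : Fin 3 → ℝ} (hg : ContDiffAt ℝ 2 g x)
    (i j : Fin 3) : pd i (pd j g) x = pd j (pd i g) x := by
  rw [pd_pd_eq hg, pd_pd_eq hg]
  exact hg.isSymmSndFDerivAt (by simp) _ _

theorem pd_add {f g : (Fin 3 → ℝ) → ℂ} {x : Fin 3 → ℝ} (hf : DifferentiableAt ℝ f x)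
    (hg : DifferentiableAt ℝ g x) (j : Fin 3) :
    pd j (fun y => f y + g y) x = pd j f x + pd j g x := by
  simp [pd, fderiv_fun_add hf hg]

theorem pd_sub {f g : (Fin 3 → ℝ) → ℂ} {x : Fin 3 → ℝ} (hf : DifferentiableAt ℝ f x)
    (hg : DifferentiableAt ℝ g x) (j : Fin 3) :
    pd j (fun y => f y - g y) x = pd j f x - pd j g x := by
  simp [pd, fderiv_fun_sub hf hg]

theorem pd_const_mul (c : ℂ) (g : (Fin 3 → ℝ) → ℂ) (x : Fin 3 → ℝ) (j : Fin 3) :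
    pd j (fun y => c * g y) x = c * pd j g x := by
  have h : fderiv ℝ (c • g) x = c • fderiv ℝ g x :=
    congrFun (fderiv_const_smul_field c) x
  exact congrArg (fun L : (Fin 3 → ℝ) →L[ℝ] ℂ => L (Pi.single j 1)) h

theorem vcurl_const_mul (c : ℂ) (f : (Fin 3 → ℝ) → Fin 3 → ℂ) (x : Fin 3 → ℝ) :
    vcurl (fun y i => c * f y i) x = fun i => c * vcurl f x i := by
  ext i
  fin_cases i <;> simp [vcurl, pd_const_mul, mul_sub]

/-- The identity `curl curl = grad div - Δ`. -/
theorem vcurl_vcurl {f : (Fin 3 → ℝ) → Fin 3 → ℂ} {x : Fin 3 → ℝ} (hf : ContDiffAt ℝ 2 f x)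
    (i : Fin 3) : vcurl (vcurl f) x i = pd i (vdiv f) x - vlap f x i := by
  have hc (k : Fin 3) : ContDiffAt ℝ 2 (fun y => f y k) x := contDiffAt_pi.1 hf k
  have hd (j k : Fin 3) : DifferentiableAt ℝ (fun y => pd j (fun z => f z k) y) x :=
    differentiableAt_pd (hc k) j
  have hcurl (j a b c d : Fin 3) :
      pd j (fun y => pd a (fun z => f z b) y - pd c (fun z => f z d) y) x =
        pd j (pd a fun z => f z b) x - pd j (pd c fun z => f z d) x :=
    pd_sub (hd a b) (hd c d) j
  have hgrad : pd i (vdiv f) x = pd i (pd 0 fun z => f z 0) x + pd i (pd 1 fun z => f z 1) x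
      + pd i (pd 2 fun z => f z 2) x :=
    (pd_add ((hd 0 0).add (hd 1 1)) (hd 2 2) i).trans
      (congrArg (· + _) (pd_add (hd 0 0) (hd 1 1) i))
  rw [hgrad]
  fin_cases i <;> simp [vcurl, vlap, hcurl]
  · rw [pd_comm (hc 1) 1 0, pd_comm (hc 2) 2 0]
    ring
  · rw [pd_comm (hc 2) 2 1, pd_comm (hc 0) 0 1]
    ring
  · rw [pd_comm (hc 0) 0 2, pd_comm (hc 1) 1 2]
    ring

/-- If e : ℝ³ → ℂ³ is C² on an open set U, satisfies the componentwise
Helmholtz equation Δe + k²·e = 0 with k² = ω²ε'μ and div e = 0 on U, then the pair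
(e, h) with h = (1/(iωμ))·curl e satisfies the Maxwell system
curl e = iωμ·h, curl h = −iωε'·e on U. -/
theorem helmholtz_div_free_implies_maxwell
    (ω μ : ℝ) (hω : 0 < ω) (hμ : 0 < μ) (ε' : ℂ)
    (U : Set (Fin 3 → ℝ)) (hU : IsOpen U)
    (e : (Fin 3 → ℝ) → Fin 3 → ℂ) (he : ContDiffOn ℝ 2 e U)
    (hHelm : ∀ x ∈ U, ∀ i : Fin 3,
      vlap e x i + (ω : ℂ) ^ 2 * ε' * (μ : ℂ) * e x i = 0)
    (hdiv : ∀ x ∈ U, vdiv e x = 0)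
    (h : (Fin 3 → ℝ) → Fin 3 → ℂ)
    (hdef : ∀ x, h x = fun i => (1 / (Complex.I * (ω : ℂ) * (μ : ℂ))) * vcurl e x i) :
    ∀ x ∈ U,
      (vcurl e x = fun i => Complex.I * (ω : ℂ) * (μ : ℂ) * h x i) ∧
      (vcurl h x = fun i => -(Complex.I * (ω : ℂ) * ε') * e x i) := by
  have hI := Complex.I_ne_zero
  have hω' : (ω : ℂ) ≠ 0 := Complex.ofReal_ne_zero.2 hω.ne'
  have hμ' : (μ : ℂ) ≠ 0 := Complex.ofReal_ne_zero.2 hμ.ne'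
  intro x hx
  have hUx : U ∈ nhds x := hU.mem_nhds hx
  refine ⟨?_, ?_⟩
  · ext i
    rw [hdef]
    field_simp
  · have hgrad (i : Fin 3) : pd i (vdiv e) x = 0 := by
      have hz : vdiv e =ᶠ[nhds x] fun _ => 0 := Filter.eventually_of_mem hUx hdiv
      simp [pd, hz.fderiv_eq]
    obtain rfl : h = fun y i => (1 / (Complex.I * (ω : ℂ) * (μ : ℂ))) * vcurl e y i :=
      funext hdef
    rw [vcurl_const_mul]
    ext i
    rw [vcurl_vcurl (he.contDiffAt hUx), hgrad, zero_sub,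
      eq_neg_of_add_eq_zero_left (hHelm x hx i)]
    field_simp
    linear_combination ε' * e x i * Complex.I_sq
end

section
/- Let ξ₁, ξ₂ be real numbers, not both zero, and set ρ = √(ξ₁² + ξ₂²). Let u : ℝ → ℂ³ have twice differentiable components u₁, u₂, u₃ satisfying uⱼ''(t) = ρ²·uⱼ(t) for all t ∈ ℝ and uⱼ(t) → 0 as t → +∞, and suppose the boundary conditions at t = 0 hold: u₁'(0) + ξ₁·u₃(0) = 0, u₂'(0) + ξ₂·u₃(0) = 0, and ξ₁·u₁(0) + ξ₂·u₂(0) − u₃'(0) = 0. Then u ≡ 0 on ℝ. -/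
open Filter Topology

/-- Solutions of the scalar equation `g' = c g` are exponentials. -/
theorem eq_mul_exp_of_hasDerivAt {g : ℝ → ℂ} {c : ℝ}
    (hg : ∀ t, HasDerivAt g ((c : ℂ) * g t) t) (t : ℝ) :
    g t = g 0 * (Real.exp (c * t) : ℂ) := by
  have hexp (s : ℝ) : HasDerivAt (fun s : ℝ => ((Real.exp (-(c * s)) : ℝ) : ℂ))
      ((Real.exp (-(c * s)) * -c : ℝ) : ℂ) s := by
    have h := ((hasDerivAt_id s).const_mul c).neg.exp.ofReal_comp
    simpa using h
  have hprod (s : ℝ) :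
      HasDerivAt (fun s => g s * ((Real.exp (-(c * s)) : ℝ) : ℂ)) 0 s := by
    refine ((hg s).fun_mul (hexp s)).congr_deriv ?_
    push_cast
    ring
  have hconst := is_const_of_deriv_eq_zero (fun s => (hprod s).differentiableAt)
    (fun s => (hprod s).deriv) t 0
  simp only [mul_zero, neg_zero, Real.exp_zero, Complex.ofReal_one, mul_one] at hconst
  rw [← hconst, mul_assoc, ← Complex.ofReal_mul, ← Real.exp_add]
  simp

/-- A solution of `f'' = ρ² f` with `ρ > 0` that decays at `+∞` satisfies `f' = -ρ f`. -/
theorem deriv_eq_neg_mul_of_tendsto_zero {f : ℝ → ℂ} {ρ : ℝ} (hρ : 0 < ρ)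
    (hf : Differentiable ℝ f) (hf' : Differentiable ℝ (deriv f))
    (hode : ∀ t, deriv (deriv f) t = (ρ : ℂ) ^ 2 * f t)
    (hlim : Tendsto f atTop (𝓝 0)) (t : ℝ) :
    deriv f t = -(ρ : ℂ) * f t := by
  have hd (t : ℝ) := (hf t).hasDerivAt
  have hd' (t : ℝ) : HasDerivAt (deriv f) ((ρ : ℂ) ^ 2 * f t) t :=
    hode t ▸ (hf' t).hasDerivAt
  have hplus := eq_mul_exp_of_hasDerivAt (g := fun t => deriv f t + ρ * f t) (c := ρ)
    fun t => by
      refine ((hd' t).fun_add ((hd t).const_mul (ρ : ℂ))).congr_deriv ?_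
      ring
  have hminus := eq_mul_exp_of_hasDerivAt (g := fun t => deriv f t - ρ * f t) (c := -ρ)
    fun t => by
      refine ((hd' t).fun_sub ((hd t).const_mul (ρ : ℂ))).congr_deriv ?_
      push_cast
      ring
  set A := deriv f 0 + ρ * f 0
  set B := deriv f 0 - ρ * f 0
  have hE : Tendsto (fun t : ℝ => ((Real.exp (-ρ * t) : ℝ) : ℂ)) atTop (𝓝 0) := by
    have h : Tendsto (fun t : ℝ => Real.exp (-ρ * t)) atTop (𝓝 0) :=
      Real.tendsto_exp_atBot.comp (tendsto_id.const_mul_atTop_of_neg (neg_lt_zero.mpr hρ))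
    exact_mod_cast (Complex.continuous_ofReal.tendsto 0).comp h
  have hAeq (t : ℝ) : A = (2 * ρ * f t + B * (Real.exp (-ρ * t) : ℂ)) *
      (Real.exp (-ρ * t) : ℂ) := by
    have hinv : (Real.exp (ρ * t) : ℂ) * (Real.exp (-ρ * t) : ℂ) = 1 := by
      rw [← Complex.ofReal_mul, ← Real.exp_add]
      simp
    linear_combination -A * hinv + (Real.exp (-ρ * t) : ℂ) * (hminus t - hplus t)
  have hA0 : A = 0 := by
    have h := ((hlim.const_mul (2 * (ρ : ℂ))).add (hE.const_mul B)).mul hE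
    simp only [mul_zero, add_zero] at h
    exact tendsto_nhds_unique (tendsto_const_nhds.congr hAeq) h
  have h := hplus t
  rw [hA0, zero_mul] at h
  linear_combination h

/-- The Lopatinsky–Shapiro condition: for (ξ₁, ξ₂) ≠ (0, 0) and
ρ = √(ξ₁² + ξ₂²), the only solution u : ℝ → ℂ³ of the ODE system uⱼ'' = ρ²·uⱼ
whose components decay at +∞ and which satisfies the boundary conditions
u₁'(0) + ξ₁·u₃(0) = 0, u₂'(0) + ξ₂·u₃(0) = 0, ξ₁·u₁(0) + ξ₂·u₂(0) − u₃'(0) = 0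
is the zero solution. -/
theorem lopatinsky_shapiro (ξ₁ ξ₂ ρ : ℝ) (hξ : (ξ₁, ξ₂) ≠ (0, 0))
    (hρ : ρ = Real.sqrt (ξ₁ ^ 2 + ξ₂ ^ 2))
    (u : ℝ → Fin 3 → ℂ)
    (hdiff : ∀ j : Fin 3, Differentiable ℝ (fun t => u t j))
    (hdiff' : ∀ j : Fin 3, Differentiable ℝ (deriv (fun t => u t j)))
    (hode : ∀ j : Fin 3, ∀ t : ℝ,
      deriv (deriv (fun s => u s j)) t = (ρ : ℂ) ^ 2 * u t j)
    (hdecay : ∀ j : Fin 3, Tendsto (fun t => u t j) atTop (𝓝 0))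
    (hbc1 : deriv (fun t => u t 0) 0 + (ξ₁ : ℂ) * u 0 2 = 0)
    (hbc2 : deriv (fun t => u t 1) 0 + (ξ₂ : ℂ) * u 0 2 = 0)
    (hbc3 : (ξ₁ : ℂ) * u 0 0 + (ξ₂ : ℂ) * u 0 1 - deriv (fun t => u t 2) 0 = 0) :
    ∀ t : ℝ, u t = 0 := by
  have hsum : 0 < ξ₁ ^ 2 + ξ₂ ^ 2 := by
    by_contra! h
    exact hξ (Prod.ext (by nlinarith [sq_nonneg ξ₁, sq_nonneg ξ₂])
      (by nlinarith [sq_nonneg ξ₁, sq_nonneg ξ₂]))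
  have hρpos : 0 < ρ := hρ ▸ Real.sqrt_pos.mpr hsum
  have hρsq : (ρ : ℂ) ^ 2 = (ξ₁ : ℂ) ^ 2 + (ξ₂ : ℂ) ^ 2 := by
    have h : ρ ^ 2 = ξ₁ ^ 2 + ξ₂ ^ 2 := by rw [hρ, Real.sq_sqrt hsum.le]
    exact_mod_cast h
  have hρ0 : (ρ : ℂ) ≠ 0 := by exact_mod_cast hρpos.ne'
  have hderiv (j : Fin 3) (t : ℝ) : deriv (fun s => u s j) t = -(ρ : ℂ) * u t j :=
    deriv_eq_neg_mul_of_tendsto_zero hρpos (hdiff j) (hdiff' j) (hode j) (hdecay j) t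
  rw [hderiv] at hbc1 hbc2 hbc3
  have h2 : u 0 2 = 0 := by
    have h : 2 * (ρ : ℂ) ^ 2 * u 0 2 = 0 := by
      linear_combination ξ₁ * hbc1 + ξ₂ * hbc2 + ρ * hbc3 + u 0 2 * hρsq
    simpa [hρ0] using h
  have h0 : u 0 0 = 0 := by simpa [h2, hρ0] using hbc1
  have h1 : u 0 1 = 0 := by simpa [h2, hρ0] using hbc2
  have hzero (j : Fin 3) : u 0 j = 0 := by
    fin_cases j
    exacts [h0, h1, h2]
  intro t
  ext j
  have h := eq_mul_exp_of_hasDerivAt (g := fun s => u s j) (c := -ρ) (fun s => by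
    have h := (hdiff j s).hasDerivAt
    rw [hderiv] at h
    simpa using h) t
  simpa [hzero j] using h
end
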